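/- arXiv:1103.2443 — 8 statements merged into one kernel-verified Lean document; each statement's English description precedes it below -/
import Mathlib

section
/- Let α ∈ ℂ and let w be a twice complex differentiable function on an open subset U of ℂ satisfying the second Painlevé equation w''(z) = 2 w(z)³ + z w(z) + α, and suppose 2 w(z)² + 2 w'(z) + z ≠ 0 for all z ∈ U. Then the Bäcklund transform W(z) := −w(z) − (2α + 1)/(2 w(z)² + 2 w'(z) + z) satisfies the second Painlevé equation with parameter α + 1 on U, i.e. W''(z) = 2 W(z)³ + z W(z) + (α + 1). -/
/-- Bäcklund transformation: if `w` is twice differentiable on an open `U ⊆ ℂ`, satisfies the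
second Painlevé equation with parameter `α`, and `2w² + 2w' + z ≠ 0` on `U`, then
`W := -w - (2α+1)/(2w² + 2w' + z)` satisfies the second Painlevé equation with
parameter `α + 1` on `U`. -/
theorem painleveII_backlund (α : ℂ) (U : Set ℂ) (hU : IsOpen U) (w w' : ℂ → ℂ)
    (hw : ∀ z ∈ U, HasDerivAt w (w' z) z)
    (hw' : ∀ z ∈ U, HasDerivAt w' (2 * w z ^ 3 + z * w z + α) z)
    (hne : ∀ z ∈ U, 2 * w z ^ 2 + 2 * w' z + z ≠ 0) :
    ∃ W' : ℂ → ℂ,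
      (∀ z ∈ U, HasDerivAt
        (fun z => -w z - (2 * α + 1) / (2 * w z ^ 2 + 2 * w' z + z)) (W' z) z) ∧
      (∀ z ∈ U, HasDerivAt W'
        (2 * (-w z - (2 * α + 1) / (2 * w z ^ 2 + 2 * w' z + z)) ^ 3
          + z * (-w z - (2 * α + 1) / (2 * w z ^ 2 + 2 * w' z + z)) + (α + 1)) z) := by
  have hD : ∀ z ∈ U, HasDerivAt (fun z => 2 * w z ^ 2 + 2 * w' z + z)
      (2 * w z * (2 * w z ^ 2 + 2 * w' z + z) + (2 * α + 1)) z := fun z hz => by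
    have h := ((((hw z hz).pow 2).const_mul 2).add ((hw' z hz).const_mul 2)).add (hasDerivAt_id z)
    refine h.congr_deriv ?_
    push_cast
    ring
  have hW : ∀ z ∈ U, HasDerivAt
      (fun z => -w z - (2 * α + 1) / (2 * w z ^ 2 + 2 * w' z + z))
      ((-w z - (2 * α + 1) / (2 * w z ^ 2 + 2 * w' z + z)) ^ 2 + z / 2
        - (2 * w z ^ 2 + 2 * w' z + z) / 2) z := fun z hz => by
    have h := (hw z hz).neg.sub ((hasDerivAt_const z (2 * α + 1)).div (hD z hz) (hne z hz))
    refine h.congr_deriv ?_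
    have hz0 := hne z hz
    have hw'z : w' z = (2 * w z ^ 2 + 2 * w' z + z - 2 * w z ^ 2 - z) / 2 := by ring
    generalize 2 * w z ^ 2 + 2 * w' z + z = D at hz0 hw'z ⊢
    rw [hw'z]
    field_simp
    ring
  refine ⟨_, hW, fun z hz => ?_⟩
  have h := (((hW z hz).pow 2).add ((hasDerivAt_id z).div_const 2)).sub ((hD z hz).div_const 2)
  refine h.congr_deriv ?_
  have hz0 := hne z hz
  push_cast
  generalize 2 * w z ^ 2 + 2 * w' z + z = D at hz0 ⊢
  field_simp
  ring
end

section
/- There exists a sequence of polynomials Q_n ∈ ℂ[z] (n ≥ 0) with Q_0 = Q_1 = 1 satisfying the recursion Q_{n+1} · Q_{n−1} = z · Q_n² + 4 (Q_n')² − 4 Q_n · Q_n'' for all n ≥ 1; in particular, for each n ≥ 1 the polynomial Q_{n−1} divides z · Q_n² + 4 (Q_n')² − 4 Q_n · Q_n'' in ℂ[z]. -/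
open Polynomial

namespace VorobevYablonski

/-- The right-hand side of the Vorobev–Yablonski recursion. -/
noncomputable def rhs (f : ℂ[X]) : ℂ[X] :=
  X * f ^ 2 + 4 * (derivative f) ^ 2 - 4 * f * derivative (derivative f)

/-- The second Hirota bilinear derivative `D² f · g`. -/
noncomputable def hirota (f g : ℂ[X]) : ℂ[X] :=
  f * derivative (derivative g) - 2 * derivative f * derivative g + derivative (derivative f) * g

lemma C_two : (C 2 : ℂ[X]) = 2 := map_ofNat C 2

lemma derivative_rhs (f : ℂ[X]) : derivative (rhs f) =
    f ^ 2 + 2 * X * f * derivative f + 4 * derivative f * derivative (derivative f)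
      - 4 * f * derivative (derivative (derivative f)) := by
  simp only [rhs, derivative_add, derivative_sub, derivative_mul, derivative_X, derivative_pow,
    derivative_ofNat]
  simp [C_two]
  ring

lemma derivative_derivative_rhs (f : ℂ[X]) : derivative (derivative (rhs f)) =
    4 * f * derivative f + 2 * X * (derivative f) ^ 2 + 2 * X * f * derivative (derivative f)
      + 4 * (derivative (derivative f)) ^ 2
      - 4 * f * derivative (derivative (derivative (derivative f))) := by
  rw [derivative_rhs]
  simp only [derivative_add, derivative_sub, derivative_mul, derivative_X, derivative_pow,
    derivative_ofNat]
  simp [C_two]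
  ring

lemma derivative_hirota (f g : ℂ[X]) : derivative (hirota f g) =
    f * derivative (derivative (derivative g)) - derivative f * derivative (derivative g)
      - derivative (derivative f) * derivative g
      + derivative (derivative (derivative f)) * g := by
  simp only [hirota, derivative_add, derivative_sub, derivative_mul, derivative_ofNat]
  ring

lemma derivative_derivative_hirota (f g : ℂ[X]) : derivative (derivative (hirota f g)) =
    f * derivative (derivative (derivative (derivative g)))
      - 2 * derivative (derivative f) * derivative (derivative g)
      + derivative (derivative (derivative (derivative f))) * g := by
  rw [derivative_hirota]
  simp only [derivative_add, derivative_sub, derivative_mul]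
  ring

lemma rhs_ne_zero {f : ℂ[X]} (hf : f ≠ 0) : rhs f ≠ 0 := by
  intro h
  have h1 : X * f ^ 2 = 4 * f * derivative (derivative f) - 4 * (derivative f) ^ 2 := by
    rw [rhs] at h
    linear_combination h
  have hd : (X * f ^ 2).natDegree = 2 * f.natDegree + 1 := by
    rw [natDegree_X_mul (pow_ne_zero 2 hf), natDegree_pow]
  have hle : (4 * f * derivative (derivative f) - 4 * (derivative f) ^ 2).natDegree
      ≤ 2 * f.natDegree := by
    have e1 : (derivative f).natDegree ≤ f.natDegree :=
      (natDegree_derivative_le f).trans (Nat.sub_le _ _)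
    have e2 : (derivative (derivative f)).natDegree ≤ f.natDegree :=
      (natDegree_derivative_le _).trans ((Nat.sub_le _ _).trans e1)
    have e4 : (4 : ℂ[X]).natDegree ≤ 0 := (natDegree_ofNat 4).le
    refine (natDegree_sub_le_of_le (natDegree_mul_le_of_le (natDegree_mul_le_of_le e4 le_rfl) e2)
      (natDegree_mul_le_of_le e4 (natDegree_pow_le_of_le 2 e1))).trans ?_
    simp only [sup_le_iff]
    omega
  rw [← h1, hd] at hle
  omega

/-- If `a * b = rhs q`, then `q` divides `b² rhs a + a² rhs b`. -/
lemma dvd_sq_mul_rhs_add {a b q : ℂ[X]} (h : a * b = rhs q) :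
    q ∣ b ^ 2 * rhs a + a ^ 2 * rhs b := by
  have key : b ^ 2 * rhs a + a ^ 2 * rhs b = 2 * X * rhs q ^ 2
      - 4 * (rhs q * derivative (derivative (rhs q)) - derivative (rhs q) ^ 2) := by
    rw [← h]
    simp only [rhs, derivative_mul, derivative_add]
    ring
  rw [key, derivative_derivative_rhs, derivative_rhs, rhs]
  generalize derivative (derivative (derivative (derivative q))) = q4
  generalize derivative (derivative (derivative q)) = q3
  generalize derivative (derivative q) = q2
  generalize derivative q = q1
  refine ⟨2 * X * (8 * q1 ^ 2 * (X * q - 4 * q2) + q * (X * q - 4 * q2) ^ 2)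
    - 4 * (4 * q1 ^ 2 * (4 * q1 + 2 * X * q2 - 4 * q4)
      + (X * q - 4 * q2) * (4 * q2 ^ 2 + 2 * X * q1 ^ 2)
      + q * (X * q - 4 * q2) * (4 * q1 + 2 * X * q2 - 4 * q4))
    + 4 * (8 * q1 * q2 * (q + 2 * X * q1 - 4 * q3) + q * (q + 2 * X * q1 - 4 * q3) ^ 2), ?_⟩
  ring

lemma dvd_rhs {a b q : ℂ[X]} (h : a * b = rhs q) (hqa : q ∣ rhs a) (hco : IsCoprime a q) :
    q ∣ rhs b := by
  have h1 : q ∣ a ^ 2 * rhs b :=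
    (dvd_add_right (hqa.mul_left (b ^ 2))).1 (dvd_sq_mul_rhs_add h)
  exact hco.symm.pow_right.dvd_of_dvd_mul_left h1

lemma eq_zero_of_hirota_eq_zero {f g : ℂ[X]} (h : hirota f g = 0) {r : ℂ} (hf : f.eval r ≠ 0)
    (hg : g.eval r = 0) (hg' : (derivative g).eval r = 0) : g = 0 := by
  by_contra hne
  obtain ⟨u, hu, hnd⟩ := g.exists_eq_pow_rootMultiplicity_mul_and_not_dvd hne r
  have hk : 1 < g.rootMultiplicity r :=
    (one_lt_rootMultiplicity_iff_isRoot hne).2 ⟨hg, hg'⟩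
  obtain ⟨k, hk⟩ := Nat.exists_eq_add_of_lt hk
  rw [show 1 + k + 1 = k + 2 by ring] at hk
  rw [hk] at hu
  rw [dvd_iff_isRoot, IsRoot.def] at hnd
  have h1 : derivative g = (X - C r) ^ (k + 1) * ((k + 2 : ℂ[X]) * u
      + (X - C r) * derivative u) := by
    rw [hu, derivative_mul, derivative_X_sub_C_pow]
    simp [C_two]
    ring
  have h2 : derivative (derivative g) = (X - C r) ^ k * ((k + 1 : ℂ[X]) * ((k + 2 : ℂ[X]) * u
      + (X - C r) * derivative u)
      + (X - C r) * derivative ((k + 2 : ℂ[X]) * u + (X - C r) * derivative u)) := by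
    rw [h1, derivative_mul, derivative_X_sub_C_pow]
    simp
    ring
  rw [hirota, h2, h1] at h
  nth_rewrite 1 [hu] at h
  have h3 : f * ((k + 1 : ℂ[X]) * ((k + 2 : ℂ[X]) * u
      + (X - C r) * derivative u)
      + (X - C r) * derivative ((k + 2 : ℂ[X]) * u + (X - C r) * derivative u))
      - 2 * derivative f * ((X - C r) * ((k + 2 : ℂ[X]) * u + (X - C r) * derivative u))
      + derivative (derivative f) * ((X - C r) ^ 2 * u) = 0 := by
    refine (mul_eq_zero.1 ?_).resolve_left (pow_ne_zero k (X_sub_C_ne_zero r))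
    linear_combination h
  have h4 := congrArg (eval r) h3
  simp [hf, hnd] at h4
  norm_cast at h4

/-- If `c * q = rhs b` then consecutive terms `b` and `q` stay coprime. -/
lemma isCoprime_next {c b q : ℂ[X]} (hb : b ≠ 0) (hco : IsCoprime c b) (h : c * q = rhs b)
    (hcb : hirota c b = 0) : IsCoprime b q := by
  rw [isCoprime_iff_aeval_ne_zero_of_isAlgClosed ℂ ℂ]
  intro r
  by_contra! hr
  simp only [coe_aeval_eq_eval] at hr
  obtain ⟨hbr, hqr⟩ := hr
  have hc : c.eval r ≠ 0 := by
    intro hc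
    obtain ⟨s, t, hst⟩ := hco
    have := congrArg (eval r) hst
    simp [hc, hbr] at this
  have h1 := congrArg (eval r) h
  simp [rhs, hbr, hqr] at h1
  exact hb (eq_zero_of_hirota_eq_zero hcb hc hbr h1)

lemma pow_mul_hirota {a b q : ℂ[X]} (h : a * b = rhs q) :
    b ^ 3 * hirota q a =
      q * (b ^ 2 * derivative (derivative (rhs q)) - 2 * b * derivative b * derivative (rhs q)
        + (2 * derivative b ^ 2 - b * derivative (derivative b)) * rhs q)
      - 2 * derivative q * (b ^ 2 * derivative (rhs q) - b * derivative b * rhs q)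
      + derivative (derivative q) * b ^ 2 * rhs q := by
  rw [← h]
  simp only [hirota, derivative_mul, derivative_add]
  ring

lemma hirota_next {a b c q : ℂ[X]} (hb : b ≠ 0) (hcb : hirota c b = 0) (hbq : hirota b q = 0)
    (hc : c * q = rhs b) (ha : a * b = rhs q) : hirota q a = 0 := by
  have h0 := hbq
  have h1 := congrArg derivative hbq
  have h2 := congrArg derivative h1
  rw [derivative_derivative_hirota] at h2
  rw [derivative_hirota] at h1
  rw [hirota] at h0
  simp only [derivative_zero] at h1 h2
  have hbc : hirota b c = 0 := by
    rw [hirota] at hcb ⊢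
    linear_combination hcb
  have ea := pow_mul_hirota ha
  have ec := pow_mul_hirota hc
  rw [hbc] at ec
  have key : b ^ 4 * hirota q a = 0 := by
    rw [derivative_derivative_rhs, derivative_rhs, rhs] at ea ec
    linear_combination b * ea + q * ec
      + (2 * q ^ 2 * b ^ 2 * X - 4 * q ^ 2 * derivative b ^ 2
        - 8 * q * derivative q * b * derivative b - 4 * derivative q ^ 2 * b ^ 2) * h0
      + (8 * q ^ 2 * b * derivative b + 8 * q * derivative q * b ^ 2) * h1
      - 4 * q ^ 2 * b ^ 2 * h2
  exact (mul_eq_zero.1 key).resolve_left (pow_ne_zero 4 hb)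

/-- Three consecutive terms `c, b, q` of the sequence, with the relations that allow the
recursion to continue. -/
structure Triple where
  (c b q : ℂ[X])
  b_ne_zero : b ≠ 0
  q_ne_zero : q ≠ 0
  mul_eq : c * q = rhs b
  dvd_rhs : b ∣ rhs c
  isCoprime : IsCoprime c b
  hirota_cb : hirota c b = 0
  hirota_bq : hirota b q = 0

lemma Triple.exists_next (t : Triple) : ∃ s : Triple, s.c = t.b ∧ s.b = t.q := by
  have hco : IsCoprime t.b t.q := isCoprime_next t.b_ne_zero t.isCoprime t.mul_eq t.hirota_cb
  obtain ⟨a, ha⟩ := VorobevYablonski.dvd_rhs t.mul_eq t.dvd_rhs t.isCoprime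
  have ha' : a * t.b = rhs t.q := by rw [ha, mul_comm]
  have ha0 : a ≠ 0 := by
    rintro rfl
    exact rhs_ne_zero t.q_ne_zero (by rw [ha, mul_zero])
  exact ⟨{ c := t.b, b := t.q, q := a
           b_ne_zero := t.q_ne_zero
           q_ne_zero := ha0
           mul_eq := ha.symm
           dvd_rhs := ⟨t.c, by rw [← t.mul_eq, mul_comm]⟩
           isCoprime := hco
           hirota_cb := t.hirota_bq
           hirota_bq := hirota_next t.b_ne_zero t.hirota_cb t.hirota_bq t.mul_eq ha' }, rfl, rfl⟩

/-- The triple `1, 1, X` of initial terms. -/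
noncomputable def Triple.initial : Triple where
  c := 1
  b := 1
  q := X
  b_ne_zero := one_ne_zero
  q_ne_zero := X_ne_zero
  mul_eq := by simp [rhs]
  dvd_rhs := one_dvd _
  isCoprime := isCoprime_one_left
  hirota_cb := by simp [hirota]
  hirota_bq := by simp [hirota]

end VorobevYablonski

/-- There exists a sequence of polynomials `Q n ∈ ℂ[z]` with `Q 0 = Q 1 = 1` satisfying the
Vorobev–Yablonski recursion `Q (n+1) * Q (n-1) = z Q n² + 4 (Q n')² - 4 Q n Q n''` for all
`n ≥ 1`; in particular `Q (n-1)` divides the right-hand side for each `n ≥ 1`. -/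
theorem vorobev_yablonski_exists :
    ∃ Q : ℕ → Polynomial ℂ, Q 0 = 1 ∧ Q 1 = 1 ∧
      (∀ n : ℕ, Q (n + 2) * Q n =
        X * (Q (n + 1)) ^ 2 + 4 * (derivative (Q (n + 1))) ^ 2
          - 4 * Q (n + 1) * derivative (derivative (Q (n + 1)))) ∧
      (∀ n : ℕ, Q n ∣
        X * (Q (n + 1)) ^ 2 + 4 * (derivative (Q (n + 1))) ^ 2
          - 4 * Q (n + 1) * derivative (derivative (Q (n + 1)))) := by
  choose next hc hb using VorobevYablonski.Triple.exists_next
  let T : ℕ → VorobevYablonski.Triple := fun n => next^[n] VorobevYablonski.Triple.initial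
  have hT : ∀ n, T (n + 1) = next (T n) := fun n => Function.iterate_succ_apply' next n _
  have hb' : ∀ n, (T (n + 1)).c = (T n).b := fun n => by rw [hT, hc]
  have hq' : ∀ n, (T (n + 2)).c = (T n).q := fun n => by rw [hb', hT, hb]
  have hrec : ∀ n, (T (n + 2)).c * (T n).c = VorobevYablonski.rhs (T (n + 1)).c := fun n => by
    rw [hq', hb', mul_comm, (T n).mul_eq]
  exact ⟨fun n => (T n).c, rfl, hb' 0, hrec, fun n => Dvd.intro_left _ (hrec n)⟩
end

section
/- For every n ≥ 0, the Vorobev–Yablonski polynomial Q_n is a monic polynomial of degree n(n−1)/2. -/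
open Polynomial

/-- The right-hand side of the Vorobev–Yablonski recursion is a monic polynomial of degree
`2 * P.natDegree + 1` whenever `P` is monic. -/
theorem vorobev_yablonski_step {R : Type*} [CommRing R] [Nontrivial R] {P : R[X]} (hP : P.Monic) :
    (X * P ^ 2 + 4 * (derivative P) ^ 2 - 4 * P * derivative (derivative P)).Monic ∧
      (X * P ^ 2 + 4 * (derivative P) ^ 2 - 4 * P * derivative (derivative P)).natDegree =
        2 * P.natDegree + 1 := by
  have hlead : (X * P ^ 2).Monic := monic_X.mul (hP.pow 2)
  have hdeg : (X * P ^ 2).natDegree = 2 * P.natDegree + 1 := by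
    rw [monic_X.natDegree_mul (hP.pow 2), hP.natDegree_pow, natDegree_X, add_comm]
  have h1 : (derivative P).natDegree ≤ P.natDegree :=
    (natDegree_derivative_le P).trans (Nat.sub_le _ _)
  have h2 : (derivative (derivative P)).natDegree ≤ P.natDegree :=
    ((natDegree_derivative_le _).trans (Nat.sub_le _ _)).trans h1
  have hlow : (C 4 * ((derivative P) ^ 2 - P * derivative (derivative P))).natDegree ≤
      2 * P.natDegree := by
    refine (natDegree_C_mul_le _ _).trans ((natDegree_sub_le _ _).trans (max_le ?_ ?_))
    · exact natDegree_pow_le_of_le 2 h1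
    · exact (natDegree_mul_le_of_le le_rfl h2).trans_eq (two_mul _).symm
  have hlt : (C 4 * ((derivative P) ^ 2 - P * derivative (derivative P))).degree <
      (X * P ^ 2).degree :=
    degree_lt_degree (by rw [hdeg]; exact Nat.lt_succ_of_le hlow)
  have heq : X * P ^ 2 + 4 * (derivative P) ^ 2 - 4 * P * derivative (derivative P) =
      X * P ^ 2 + C 4 * ((derivative P) ^ 2 - P * derivative (derivative P)) := by
    rw [show (C 4 : R[X]) = 4 from rfl]
    ring
  rw [heq]
  exact ⟨hlead.add_of_left hlt, by rw [natDegree_add_eq_left_of_degree_lt hlt, hdeg]⟩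

/-- Every Vorobev–Yablonski polynomial `Q n` is monic of degree `n(n-1)/2`. -/
theorem vorobev_yablonski_monic_degree (Q : ℕ → Polynomial ℂ)
    (hQ0 : Q 0 = 1) (hQ1 : Q 1 = 1)
    (hrec : ∀ n : ℕ, Q (n + 2) * Q n =
      X * (Q (n + 1)) ^ 2 + 4 * (derivative (Q (n + 1))) ^ 2
        - 4 * Q (n + 1) * derivative (derivative (Q (n + 1)))) :
    ∀ n : ℕ, (Q n).Monic ∧ (Q n).natDegree = n * (n - 1) / 2 := by
  intro n
  rw [← Nat.choose_two_right]
  induction n using Nat.twoStepInduction with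
  | zero => simp [hQ0]
  | one => simp [hQ1]
  | more n ih0 ih1 =>
    obtain ⟨hm, hd⟩ := vorobev_yablonski_step ih1.1
    rw [← hrec n] at hm hd
    have hmon : (Q (n + 2)).Monic := ih0.1.of_mul_monic_right hm
    refine ⟨hmon, ?_⟩
    rw [hmon.natDegree_mul ih0.1, ih0.2, ih1.2] at hd
    have e1 : (n + 1).choose 2 = n + n.choose 2 := by
      rw [Nat.choose_succ_succ' n 1, Nat.choose_one_right]
    have e2 : (n + 2).choose 2 = n + 1 + (n + 1).choose 2 := by
      rw [Nat.choose_succ_succ' (n + 1) 1, Nat.choose_one_right]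
    omega
end

section
/- For every positive integer n, all roots of the Vorobev–Yablonski polynomial Q_n in ℂ are simple (i.e. Q_n is squarefree: Q_n and its derivative Q_n' have no common root). -/
open Polynomial

theorem X_sub_C_mul_derivative_pow_mul (c : ℂ) (a : ℕ) (F : ℂ[X]) :
    (X - C c) * derivative ((X - C c) ^ a * F) =
      (X - C c) ^ a * ((a : ℂ[X]) * F + (X - C c) * derivative F) := by
  cases a with
  | zero => simp
  | succ k =>
    simp only [derivative_mul, derivative_X_sub_C_pow, Nat.add_sub_cancel, map_natCast]
    ring

theorem X_sub_C_sq_mul_derivative_derivative_pow_mul (c : ℂ) (a : ℕ) (F : ℂ[X]) :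
    (X - C c) ^ 2 * derivative (derivative ((X - C c) ^ a * F)) =
      (X - C c) ^ a * ((a : ℂ[X]) * ((a : ℂ[X]) - 1) * F + 2 * (a : ℂ[X]) * (X - C c) * derivative F
        + (X - C c) ^ 2 * derivative (derivative F)) := by
  have h := congrArg derivative (X_sub_C_mul_derivative_pow_mul c a F)
  rw [derivative_mul] at h
  have h1 := X_sub_C_mul_derivative_pow_mul c a F
  have h2 := X_sub_C_mul_derivative_pow_mul c a
    ((a : ℂ[X]) * F + (X - C c) * derivative F)
  simp only [derivative_add, derivative_mul, derivative_sub, derivative_X, derivative_C,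
    derivative_natCast] at h h1 h2 ⊢
  linear_combination (X - C c) * h - h1 + h2

/-- If `f'' g - 2 f' g' + f g'' = 0`, then the multiplicities `a`, `m` of a point as a root of
`f`, `g` satisfy `(a - m)² = a + m`. -/
theorem sq_sub_eq_add_of_bilinear_eq_zero {c : ℂ} {a m : ℕ} {F G : ℂ[X]}
    (hF : F.eval c ≠ 0) (hG : G.eval c ≠ 0)
    (hB : derivative (derivative ((X - C c) ^ a * F)) * ((X - C c) ^ m * G)
      - 2 * derivative ((X - C c) ^ a * F) * derivative ((X - C c) ^ m * G)
      + (X - C c) ^ a * F * derivative (derivative ((X - C c) ^ m * G)) = 0) :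
    ((a : ℤ) - m) ^ 2 = a + m := by
  have f1 := X_sub_C_mul_derivative_pow_mul c a F
  have f2 := X_sub_C_sq_mul_derivative_derivative_pow_mul c a F
  have g1 := X_sub_C_mul_derivative_pow_mul c m G
  have g2 := X_sub_C_sq_mul_derivative_derivative_pow_mul c m G
  generalize derivative (derivative ((X - C c) ^ a * F)) = f'' at *
  generalize derivative ((X - C c) ^ a * F) = f' at *
  generalize derivative (derivative ((X - C c) ^ m * G)) = g'' at *
  generalize derivative ((X - C c) ^ m * G) = g' at *
  have key : (X - C c) ^ (a + m) *
      (((a : ℂ[X]) * ((a : ℂ[X]) - 1) * F + 2 * (a : ℂ[X]) * (X - C c) * derivative F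
        + (X - C c) ^ 2 * derivative (derivative F)) * G
      - 2 * ((a : ℂ[X]) * F + (X - C c) * derivative F)
        * ((m : ℂ[X]) * G + (X - C c) * derivative G)
      + F * ((m : ℂ[X]) * ((m : ℂ[X]) - 1) * G + 2 * (m : ℂ[X]) * (X - C c) * derivative G
        + (X - C c) ^ 2 * derivative (derivative G))) = 0 := by
    rw [pow_add]
    linear_combination (X - C c) ^ 2 * hB - (X - C c) ^ m * G * f2 - (X - C c) ^ a * F * g2
      + 2 * (X - C c) * g' * f1
      + 2 * (X - C c) ^ a * ((a : ℂ[X]) * F + (X - C c) * derivative F) * g1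
  have key2 := congrArg (eval c)
    ((mul_eq_zero.mp key).resolve_left (pow_ne_zero _ (X_sub_C_ne_zero c)))
  simp at key2
  have h0 : (F.eval c * G.eval c) * (((a : ℂ) - m) ^ 2 - (a + m)) = 0 := by
    linear_combination key2
  have h1 := (mul_eq_zero.mp h0).resolve_left (mul_ne_zero hF hG)
  have h2 : ((a : ℂ) - m) ^ 2 = a + m := by linear_combination h1
  exact_mod_cast h2

theorem eq_of_X_sub_C_pow_mul_eq {c : ℂ} {a m : ℕ} {F G : ℂ[X]}
    (hF : F.eval c ≠ 0) (hG : G.eval c ≠ 0)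
    (h : (X - C c) ^ a * F = (X - C c) ^ m * G) : a = m := by
  have aux : ∀ {a : ℕ} {F : ℂ[X]}, F.eval c ≠ 0 →
      rootMultiplicity c ((X - C c) ^ a * F) = a := by
    intro a F hF
    have hF0 : F ≠ 0 := by rintro rfl; simp at hF
    rw [rootMultiplicity_mul (mul_ne_zero (pow_ne_zero _ (X_sub_C_ne_zero c)) hF0),
      rootMultiplicity_X_sub_C_pow, rootMultiplicity_eq_zero (by simpa using hF), add_zero]
  rw [← aux (a := a) hF, h, aux hG]

/-- The multiplicities of a root of `g` in the relation `h f = X g² + 4 g'² - 4 g g''`. -/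
theorem add_add_two_eq_of_toda {c : ℂ} {a m b : ℕ} {F G H : ℂ[X]} (hm : m ≠ 0)
    (hF : F.eval c ≠ 0) (hG : G.eval c ≠ 0) (hH : H.eval c ≠ 0)
    (hT : (X - C c) ^ b * H * ((X - C c) ^ a * F) =
      X * ((X - C c) ^ m * G) ^ 2 + 4 * (derivative ((X - C c) ^ m * G)) ^ 2
        - 4 * ((X - C c) ^ m * G) * derivative (derivative ((X - C c) ^ m * G))) :
    a + b + 2 = 2 * m := by
  have g1 := X_sub_C_mul_derivative_pow_mul c m G
  have g2 := X_sub_C_sq_mul_derivative_derivative_pow_mul c m G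
  generalize derivative (derivative ((X - C c) ^ m * G)) = g'' at *
  generalize derivative ((X - C c) ^ m * G) = g' at *
  refine eq_of_X_sub_C_pow_mul_eq (c := c) (F := H * F)
    (G := X * (X - C c) ^ 2 * G ^ 2 + 4 * ((m : ℂ[X]) * G + (X - C c) * derivative G) ^ 2
      - 4 * G * ((m : ℂ[X]) * ((m : ℂ[X]) - 1) * G + 2 * (m : ℂ[X]) * (X - C c) * derivative G
        + (X - C c) ^ 2 * derivative (derivative G))) ?_ ?_ ?_
  · simpa using ⟨hH, hF⟩
  · have e : 4 * (m : ℂ) * eval c G ^ 2 ≠ 0 := by simp [hm, hG]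
    simp
    convert e using 1
    ring_nf
  · rw [pow_add, pow_add, two_mul, pow_add]
    linear_combination (X - C c) ^ 2 * hT
      + 4 * ((X - C c) * g' + (X - C c) ^ m * ((m : ℂ[X]) * G + (X - C c) * derivative G)) * g1
      - 4 * (X - C c) ^ m * G * g2

theorem X_mul_sq_add_ne_zero {g : ℂ[X]} (hg : g ≠ 0) :
    X * g ^ 2 + 4 * (derivative g) ^ 2 - 4 * g * derivative (derivative g) ≠ 0 := by
  intro h
  have e : X * g ^ 2 = 4 * (g * derivative (derivative g) - (derivative g) ^ 2) := by
    linear_combination h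
  have h1 : (X * g ^ 2).natDegree = 2 * g.natDegree + 1 := by
    rw [natDegree_X_mul (pow_ne_zero _ hg), natDegree_pow]
  have h2 : (4 * (g * derivative (derivative g) - (derivative g) ^ 2)).natDegree
      ≤ 2 * g.natDegree := by
    have d1 := natDegree_derivative_le g
    have d2 := natDegree_derivative_le (derivative g)
    have e4 : (4 : ℂ[X]) = C 4 := rfl
    rw [e4]
    refine (natDegree_C_mul_le _ _).trans ((natDegree_sub_le _ _).trans (max_le ?_ ?_))
    · refine natDegree_mul_le.trans ?_
      omega
    · refine natDegree_pow_le.trans ?_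
      omega
  rw [← e, h1] at h2
  omega

/-- The quadratic identity `f h' - f' h = κ g²` propagates `f'' g - 2 f' g' + f g'' = 0`
from `(f, g)` to `(g, h)`. -/
theorem bilinear_eq_zero_step {f g h : ℂ[X]} {κ : ℂ} (hf : f ≠ 0)
    (hB : derivative (derivative f) * g - 2 * derivative f * derivative g
      + f * derivative (derivative g) = 0)
    (hJ : f * derivative h - derivative f * h = C κ * g ^ 2) :
    derivative (derivative g) * h - 2 * derivative g * derivative h
      + g * derivative (derivative h) = 0 := by
  have hJ' := congrArg derivative hJ
  simp only [derivative_sub, derivative_mul, derivative_C, sq] at hJ'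
  simp only [zero_mul, zero_add] at hJ'
  apply (mul_eq_zero.mp _).resolve_left hf
  linear_combination h * hB + g * hJ' - 2 * derivative g * hJ

/-- The quadratic identity `f h' - f' h = κ g²` for consecutive terms of the recursion
propagates, with `κ` replaced by `κ + 2`. -/
theorem quadratic_step {f g h k : ℂ[X]} {κ : ℂ} (hg : g ≠ 0)
    (hB : derivative (derivative g) * h - 2 * derivative g * derivative h
      + g * derivative (derivative h) = 0)
    (hJ : f * derivative h - derivative f * h = C κ * g ^ 2)
    (hT : h * f = X * g ^ 2 + 4 * (derivative g) ^ 2 - 4 * g * derivative (derivative g))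
    (hT2 : k * g = X * h ^ 2 + 4 * (derivative h) ^ 2 - 4 * h * derivative (derivative h)) :
    g * derivative k - derivative g * k = C (κ + 2) * h ^ 2 := by
  have hB' := congrArg derivative hB
  have hT' := congrArg derivative hT
  have hT2' := congrArg derivative hT2
  simp only [derivative_sub, derivative_add, derivative_mul, sq, derivative_X,
    derivative_ofNat, derivative_zero] at hB' hT' hT2'
  have e2 : (C (κ + 2) : ℂ[X]) = C κ + 2 := by rw [C_add]; rfl
  rw [e2]
  have third : g * (2 * X * derivative h - 4 * derivative (derivative (derivative h)))
      - 2 * X * derivative g * h + 8 * derivative g * derivative (derivative h)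
      - 4 * derivative h * derivative (derivative g) = (C κ + 1) * g * h := by
    apply mul_left_cancel₀ hg
    linear_combination h * hT' + h * hJ - 2 * derivative h * hT - 4 * g * hB'
      + 4 * derivative g * hB
  apply mul_left_cancel₀ hg
  linear_combination g * hT2' - 2 * derivative g * hT2 + h * third + 4 * derivative h * hB

/-- For every positive integer `n`, all roots of the Vorobev–Yablonski polynomial `Q n` are
simple: `Q n` and its derivative have no common root. -/
theorem vorobev_yablonski_simple_roots (Q : ℕ → Polynomial ℂ)
    (hQ0 : Q 0 = 1) (hQ1 : Q 1 = 1)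
    (hrec : ∀ n : ℕ, Q (n + 2) * Q n =
      X * (Q (n + 1)) ^ 2 + 4 * (derivative (Q (n + 1))) ^ 2
        - 4 * Q (n + 1) * derivative (derivative (Q (n + 1)))) :
    ∀ n : ℕ, 0 < n → ∀ c : ℂ,
      ¬((Q n).eval c = 0 ∧ (derivative (Q n)).eval c = 0) := by
  have hne : ∀ n, Q n ≠ 0 ∧ Q (n + 1) ≠ 0 := by
    intro n
    induction n with
    | zero => simp [hQ0, hQ1]
    | succ n ih =>
      exact ⟨ih.2, left_ne_zero_of_mul (hrec n ▸ X_mul_sq_add_ne_zero ih.2)⟩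
  have hmain : ∀ n, (derivative (derivative (Q n)) * Q (n + 1)
      - 2 * derivative (Q n) * derivative (Q (n + 1))
      + Q n * derivative (derivative (Q (n + 1))) = 0) ∧
      ∃ κ : ℂ, Q n * derivative (Q (n + 2)) - derivative (Q n) * Q (n + 2)
        = C κ * Q (n + 1) ^ 2 := by
    intro n
    induction n with
    | zero =>
      have h2 : Q 2 = X := by simpa [hQ0, hQ1] using hrec 0
      exact ⟨by simp [hQ0, hQ1], 1, by simp [hQ0, hQ1, h2]⟩
    | succ n ih =>
      obtain ⟨hB, κ, hJ⟩ := ih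
      have hB2 := bilinear_eq_zero_step (hne n).1 hB hJ
      exact ⟨hB2, κ + 2, quadratic_step (hne n).2 hB2 hJ (hrec n) (hrec (n + 1))⟩
  rintro n hn c ⟨h0, h1⟩
  obtain ⟨n, rfl⟩ := Nat.exists_eq_succ_of_ne_zero hn.ne'
  have hfac : ∀ k, ∃ a F, Q k = (X - C c) ^ a * F ∧ eval c F ≠ 0 := by
    intro k
    obtain ⟨F, hF, hd⟩ := exists_eq_pow_rootMultiplicity_mul_and_not_dvd (Q k) (hne k).1 c
    exact ⟨_, F, hF, fun h => hd (dvd_iff_isRoot.mpr h)⟩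
  obtain ⟨a, F, ha, hF⟩ := hfac n
  obtain ⟨m, G, hm, hG⟩ := hfac (n + 1)
  obtain ⟨b, H, hb, hH⟩ := hfac (n + 2)
  have hB1 := (hmain n).1
  have hB2 := (hmain (n + 1)).1
  have hT := hrec n
  rw [Nat.succ_eq_add_one, hm] at h0 h1
  rw [ha, hm] at hB1
  rw [hm, hb] at hB2
  rw [ha, hm, hb] at hT
  have hm0 : m ≠ 0 := by
    rintro rfl
    simp at h0
    exact hG h0
  have hm1 : m ≠ 1 := by
    rintro rfl
    simp at h1
    exact hG h1
  have e1 := sq_sub_eq_add_of_bilinear_eq_zero hF hG hB1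
  have e2 := sq_sub_eq_add_of_bilinear_eq_zero hG hH hB2
  have e3 : (a : ℤ) + b + 2 = 2 * m := by
    exact_mod_cast add_add_two_eq_of_toda hm0 hF hG hH hT
  have hb' : (b : ℤ) = 2 * m - 2 - a := by linarith
  rw [hb'] at e2
  have e4 : (a : ℤ) = m - 1 := by linarith
  rw [e4] at e1
  apply hm1
  have : (m : ℤ) = 1 := by linarith
  exact_mod_cast this
end

section
/- For every positive integer n, the Vorobev–Yablonski polynomials Q_n and Q_{n+1} have no common root in ℂ (equivalently, Q_n and Q_{n+1} are coprime in ℂ[z]). -/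
open Polynomial

/-- A nonzero solution `g` of the bilinear equation `D² f · g = 0` has only simple zeros away from
the zeros of `f`. -/
theorem derivative_eval_ne_zero_of_hirota_sq {f g : ℂ[X]} (hg : g ≠ 0)
    (h : derivative (derivative f) * g - 2 * derivative f * derivative g
      + f * derivative (derivative g) = 0)
    {c : ℂ} (hfc : f.eval c ≠ 0) (hgc : g.eval c = 0) : (derivative g).eval c ≠ 0 := by
  intro hgc'
  have hmult : 1 < g.rootMultiplicity c :=
    (one_lt_rootMultiplicity_iff_isRoot hg).2 ⟨hgc, hgc'⟩
  obtain ⟨p, hp, hndvd⟩ := exists_eq_pow_rootMultiplicity_mul_and_not_dvd g hg c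
  obtain ⟨j, hj⟩ : ∃ j, g.rootMultiplicity c = j + 2 := ⟨_, (Nat.sub_add_cancel hmult).symm⟩
  rw [hj] at hp
  have hg1 : derivative g = (X - C c) ^ (j + 1) *
      (((j : ℂ[X]) + 2) * p + (X - C c) * derivative p) := by
    rw [hp]
    simp [derivative_mul, derivative_X_sub_C_pow, map_ofNat C 2]
    ring
  have hg2 : derivative (derivative g) = (X - C c) ^ j *
      (((j : ℂ[X]) + 2) * ((j : ℂ[X]) + 1) * p + 2 * ((j : ℂ[X]) + 2) * (X - C c) * derivative p
        + (X - C c) ^ 2 * derivative (derivative p)) := by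
    rw [hg1]
    simp [derivative_mul, derivative_X_sub_C_pow]
    ring
  have hfac : derivative (derivative f) * ((X - C c) ^ 2 * p)
      - 2 * derivative f * ((X - C c) * (((j : ℂ[X]) + 2) * p + (X - C c) * derivative p))
      + f * (((j : ℂ[X]) + 2) * ((j : ℂ[X]) + 1) * p + 2 * ((j : ℂ[X]) + 2) * (X - C c) * derivative p
        + (X - C c) ^ 2 * derivative (derivative p)) = 0 := by
    refine (mul_eq_zero.1 ?_).resolve_left (pow_ne_zero j (X_sub_C_ne_zero c))
    rw [hg2, hg1, hp] at h
    linear_combination h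
  have heval := congrArg (eval c) hfac
  simp at heval
  have h1 : (j : ℂ) + 1 ≠ 0 := by exact_mod_cast j.succ_ne_zero
  have h2 : (j : ℂ) + 2 ≠ 0 := by exact_mod_cast (j + 1).succ_ne_zero
  have hpc : p.eval c = 0 := by simp_all
  exact hndvd (dvd_iff_isRoot.2 hpc)

/-- One step of the Vorobev–Yablonski recursion turns the bilinear equations `D² f · g = 0` and
`(D³ - z D - a) f · g = 0` into a Wronskian identity, and propagates both equations from `(f, g)`
to `(g, h)`, with `a` replaced by `a + 1`. -/
theorem hirota_step {f g h : ℂ[X]} {a : ℂ} (hf : f ≠ 0)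
    (hrec : h * f = X * g ^ 2 + 4 * (derivative g) ^ 2 - 4 * g * derivative (derivative g))
    (h2 : derivative (derivative f) * g - 2 * derivative f * derivative g
      + f * derivative (derivative g) = 0)
    (h3 : derivative (derivative (derivative f)) * g
      - 3 * derivative (derivative f) * derivative g
      + 3 * derivative f * derivative (derivative g)
      - f * derivative (derivative (derivative g))
      - X * (derivative f * g - f * derivative g) - C a * f * g = 0) :
    derivative h * f - h * derivative f = (2 * C a + 1) * g ^ 2 ∧
    derivative (derivative g) * h - 2 * derivative g * derivative h
      + g * derivative (derivative h) = 0 ∧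
    derivative (derivative (derivative g)) * h
      - 3 * derivative (derivative g) * derivative h
      + 3 * derivative g * derivative (derivative h)
      - g * derivative (derivative (derivative h))
      - X * (derivative g * h - g * derivative h) - C (a + 1) * g * h = 0 := by
  have hrec' := congrArg derivative hrec
  have h2' := congrArg derivative h2
  simp [derivative_mul, derivative_pow, map_ofNat C 2] at hrec' h2'
  have hW : derivative h * f - h * derivative f = (2 * C a + 1) * g ^ 2 := by
    refine mul_left_cancel₀ hf ?_
    linear_combination f * hrec' - 2 * derivative f * hrec + 2 * g * (h3 - h2')
      + 4 * derivative g * h2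
  have hW' := congrArg derivative hW
  have hW'' := congrArg (fun p => derivative (derivative p)) hW
  simp [derivative_mul, derivative_pow, map_ofNat C 2] at hW' hW''
  have hmix : derivative h * derivative (derivative f) - derivative (derivative h) * derivative f
      = -(2 * C a + 1) * g * derivative (derivative g) := by
    refine mul_left_cancel₀ hf ?_
    linear_combination derivative (derivative f) * hW - derivative f * hW'
      + (2 * C a + 1) * g * h2
  refine ⟨hW, mul_left_cancel₀ hf ?_, mul_left_cancel₀ hf ?_⟩
  · linear_combination h * h2 + g * hW' - 2 * derivative g * hW
  · rw [C_add, C_1]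
    linear_combination -h * h3 - 3 * derivative (derivative g) * hW + 3 * derivative g * hW'
      - g * hW'' - g * hmix + X * g * hW - (2 * C a + 1) * g * hrec

/-- For every positive integer `n`, the Vorobev–Yablonski polynomials `Q n` and `Q (n+1)`
have no common root in `ℂ`. -/
theorem vorobev_yablonski_no_common_root (Q : ℕ → Polynomial ℂ)
    (hQ0 : Q 0 = 1) (hQ1 : Q 1 = 1)
    (hrec : ∀ n : ℕ, Q (n + 2) * Q n =
      X * (Q (n + 1)) ^ 2 + 4 * (derivative (Q (n + 1))) ^ 2
        - 4 * Q (n + 1) * derivative (derivative (Q (n + 1)))) :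
    ∀ n : ℕ, 0 < n → ∀ c : ℂ,
      ¬((Q n).eval c = 0 ∧ (Q (n + 1)).eval c = 0) := by
  have key : ∀ n : ℕ, Q n ≠ 0 ∧ Q (n + 1) ≠ 0 ∧
      (derivative (derivative (Q n)) * Q (n + 1) - 2 * derivative (Q n) * derivative (Q (n + 1))
        + Q n * derivative (derivative (Q (n + 1))) = 0) ∧
      (derivative (derivative (derivative (Q n))) * Q (n + 1)
        - 3 * derivative (derivative (Q n)) * derivative (Q (n + 1))
        + 3 * derivative (Q n) * derivative (derivative (Q (n + 1)))
        - Q n * derivative (derivative (derivative (Q (n + 1))))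
        - X * (derivative (Q n) * Q (n + 1) - Q n * derivative (Q (n + 1)))
        - C (n : ℂ) * Q n * Q (n + 1) = 0) := by
    intro n
    induction n with
    | zero => simp [hQ0, hQ1]
    | succ n ih =>
      obtain ⟨hf, hg, h2, h3⟩ := ih
      obtain ⟨hW, h2', h3'⟩ := hirota_step hf (hrec n) h2 h3
      refine ⟨hg, fun hh => ?_, h2', by exact_mod_cast h3'⟩
      have hκ : 2 * (n : ℂ[X]) + 1 ≠ 0 := by
        exact_mod_cast (2 * n).succ_ne_zero
      rw [show n + 1 + 1 = n + 2 from rfl] at hh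
      rw [hh] at hW
      simp [hκ, hg] at hW
  have main : ∀ n : ℕ, ∀ c : ℂ, ¬((Q n).eval c = 0 ∧ (Q (n + 1)).eval c = 0) := by
    intro n c
    induction n with
    | zero => simp [hQ0]
    | succ n ih =>
      rintro ⟨hg, hh⟩
      obtain ⟨-, hg0, h2, -⟩ := key n
      refine derivative_eval_ne_zero_of_hirota_sq hg0 h2 (fun hf => ih ⟨hf, hg⟩) hg ?_
      have heval := congrArg (eval c) (hrec n)
      rw [show n + 1 + 1 = n + 2 from rfl] at hh
      simpa [hg, hh] using heval
  exact fun n _ => main n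
end

section
/- For every n ∈ ℕ, the rational function w(z,n) := Q_n'(z)/Q_n(z) − Q_{n+1}'(z)/Q_{n+1}(z) satisfies the second Painlevé equation with parameter α = n, i.e. w''(z) = 2 w(z)³ + z w(z) + n, at every point z ∈ ℂ with Q_n(z) ≠ 0 and Q_{n+1}(z) ≠ 0. -/
open Polynomial

/-- The derivative of the second Hirota bilinear relation `D² a·b = 0`. -/
lemma derivative_hirota_two {R : Type*} [CommRing R] {a b : R[X]}
    (h : derivative (derivative a) * b - 2 * derivative a * derivative b
      + a * derivative (derivative b) = 0) :
    derivative (derivative (derivative a)) * b - derivative (derivative a) * derivative b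
      - derivative a * derivative (derivative b)
      + a * derivative (derivative (derivative b)) = 0 := by
  have h' := congrArg derivative h
  simp only [derivative_mul, derivative_add, derivative_sub, derivative_zero,
    derivative_ofNat] at h'
  linear_combination h'

/-- The Hirota bilinear form of the second Painlevé equation for `a'/a - b'/b`, together with the
Toda-type recursion, determines the Wronskian of `a` and `c`. -/
lemma wronskian_of_hirota {R : Type*} [CommRing R] [IsDomain R]
    {a b c : R[X]} {n : ℕ} (ha : a ≠ 0)
    (h₂ : derivative (derivative a) * b - 2 * derivative a * derivative b
      + a * derivative (derivative b) = 0)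
    (h₃ : derivative (derivative (derivative a)) * b
      - 3 * derivative (derivative a) * derivative b
      + 3 * derivative a * derivative (derivative b)
      - a * derivative (derivative (derivative b))
      = X * (derivative a * b - a * derivative b) + (n : R[X]) * (a * b))
    (hrec : c * a = X * b ^ 2 + 4 * derivative b ^ 2 - 4 * b * derivative (derivative b)) :
    derivative a * c - a * derivative c = -(2 * (n : R[X]) + 1) * b ^ 2 := by
  have h₂' := derivative_hirota_two h₂
  have hrec' := congrArg derivative hrec
  simp only [derivative_mul, derivative_add, derivative_sub, derivative_pow, derivative_X,
    derivative_ofNat, Nat.cast_ofNat, Nat.add_one_sub_one, pow_one,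
    map_ofNat] at hrec'
  apply mul_left_cancel₀ ha
  linear_combination 2 * derivative a * hrec - a * hrec' - 2 * b * h₃ + 2 * b * h₂'
    - 4 * derivative b * h₂

/-- The second Hirota relation passes from the pair `(a, b)` to the pair `(b, c)`. -/
lemma hirota_two_succ {R : Type*} [CommRing R] [IsDomain R]
    {a b c k : R[X]} (ha : a ≠ 0) (hk : derivative k = 0)
    (h₂ : derivative (derivative a) * b - 2 * derivative a * derivative b
      + a * derivative (derivative b) = 0)
    (hw : derivative a * c - a * derivative c = -k * b ^ 2) :
    derivative (derivative b) * c - 2 * derivative b * derivative c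
      + b * derivative (derivative c) = 0 := by
  have hw' := congrArg derivative hw
  simp only [derivative_mul, derivative_sub, derivative_neg, derivative_pow, hk,
    Nat.cast_ofNat, Nat.add_one_sub_one, pow_one, map_ofNat] at hw'
  apply mul_left_cancel₀ ha
  linear_combination c * h₂ - b * hw' + 2 * derivative b * hw

/-- The third Hirota relation passes from the pair `(a, b)` to the pair `(b, c)`, with the
parameter increased by one. -/
lemma hirota_three_succ {R : Type*} [CommRing R] [IsDomain R]
    {a b c : R[X]} {n : ℕ} (ha : a ≠ 0)
    (h₂ : derivative (derivative a) * b - 2 * derivative a * derivative b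
      + a * derivative (derivative b) = 0)
    (h₃ : derivative (derivative (derivative a)) * b
      - 3 * derivative (derivative a) * derivative b
      + 3 * derivative a * derivative (derivative b)
      - a * derivative (derivative (derivative b))
      = X * (derivative a * b - a * derivative b) + (n : R[X]) * (a * b))
    (hrec : c * a = X * b ^ 2 + 4 * derivative b ^ 2 - 4 * b * derivative (derivative b))
    (hw : derivative a * c - a * derivative c = -(2 * (n : R[X]) + 1) * b ^ 2) :
    derivative (derivative (derivative b)) * c
      - 3 * derivative (derivative b) * derivative c
      + 3 * derivative b * derivative (derivative c)
      - b * derivative (derivative (derivative c))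
      = X * (derivative b * c - b * derivative c) + ((n + 1 : ℕ) : R[X]) * (b * c) := by
  have hw' : derivative (derivative a) * c - a * derivative (derivative c)
      = -2 * (2 * (n : R[X]) + 1) * b * derivative b := by
    have h := congrArg derivative hw
    simp only [derivative_mul, derivative_add, derivative_sub, derivative_neg, derivative_pow,
      derivative_one, derivative_ofNat, derivative_natCast, Nat.cast_ofNat,
      Nat.add_one_sub_one, pow_one, map_ofNat] at h
    linear_combination h
  have hw'' : derivative (derivative (derivative a)) * c
      + derivative (derivative a) * derivative c - derivative a * derivative (derivative c)
      - a * derivative (derivative (derivative c))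
      = -2 * (2 * (n : R[X]) + 1) * (derivative b ^ 2 + b * derivative (derivative b)) := by
    have h := congrArg derivative hw'
    simp only [derivative_mul, derivative_add, derivative_sub, derivative_neg,
      derivative_one, derivative_ofNat, derivative_natCast] at h
    linear_combination h
  have hcross : derivative (derivative a) * derivative c
      - derivative a * derivative (derivative c)
      = -(2 * (n : R[X]) + 1) * b * derivative (derivative b) := by
    apply mul_left_cancel₀ ha
    linear_combination (2 * (n : R[X]) + 1) * b * h₂
      - derivative (derivative a) * hw + derivative a * hw'
  apply mul_left_cancel₀ ha
  push_cast
  linear_combination -c * h₃ + 3 * derivative (derivative b) * hw - 3 * derivative b * hw'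
    + b * hw'' - b * hcross - X * b * hw - (2 * (n : R[X]) + 1) * b * hrec

/-- Consecutive Vorobev–Yablonski polynomials are nonzero and satisfy the Hirota bilinear form of
the second Painlevé equation. -/
lemma vorobev_yablonski_hirota {R : Type*} [CommRing R] [IsDomain R] [CharZero R]
    (Q : ℕ → R[X]) (hQ0 : Q 0 = 1) (hQ1 : Q 1 = 1)
    (hrec : ∀ n : ℕ, Q (n + 2) * Q n =
      X * (Q (n + 1)) ^ 2 + 4 * (derivative (Q (n + 1))) ^ 2
        - 4 * Q (n + 1) * derivative (derivative (Q (n + 1)))) (n : ℕ) :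
    Q n ≠ 0 ∧ Q (n + 1) ≠ 0 ∧
    derivative (derivative (Q n)) * Q (n + 1) - 2 * derivative (Q n) * derivative (Q (n + 1))
      + Q n * derivative (derivative (Q (n + 1))) = 0 ∧
    derivative (derivative (derivative (Q n))) * Q (n + 1)
      - 3 * derivative (derivative (Q n)) * derivative (Q (n + 1))
      + 3 * derivative (Q n) * derivative (derivative (Q (n + 1)))
      - Q n * derivative (derivative (derivative (Q (n + 1))))
      = X * (derivative (Q n) * Q (n + 1) - Q n * derivative (Q (n + 1)))
        + (n : R[X]) * (Q n * Q (n + 1)) := by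
  induction n with
  | zero => simp [hQ0, hQ1]
  | succ n ih =>
    obtain ⟨ha, hb, h₂, h₃⟩ := ih
    have hw := wronskian_of_hirota ha h₂ h₃ (hrec n)
    refine ⟨hb, fun hc => ?_, hirota_two_succ ha (by simp) h₂ hw,
      hirota_three_succ ha h₂ h₃ (hrec n) hw⟩
    have hk : (2 * (n : R[X]) + 1) ≠ 0 := by exact_mod_cast (2 * n).succ_ne_zero
    have hzero : (2 * (n : R[X]) + 1) * Q (n + 1) ^ 2 = 0 := by
      rw [show n + 1 + 1 = n + 2 from rfl] at hc
      rw [hc] at hw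
      simp only [mul_zero, derivative_zero, sub_zero] at hw
      linear_combination hw
    exact mul_ne_zero hk (pow_ne_zero 2 hb) hzero

/-- The derivative of the logarithmic derivative of a polynomial. -/
lemma hasDerivAt_logDeriv_eval {𝕜 : Type*} [NontriviallyNormedField 𝕜] (p : 𝕜[X]) {z : 𝕜}
    (hz : p.eval z ≠ 0) :
    HasDerivAt (fun z => (derivative p).eval z / p.eval z)
      ((derivative (derivative p)).eval z / p.eval z
        - ((derivative p).eval z / p.eval z) ^ 2) z := by
  refine (((derivative p).hasDerivAt z).div (p.hasDerivAt z) hz).congr_deriv ?_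
  field_simp

/-- The second derivative of the logarithmic derivative of a polynomial. -/
lemma hasDerivAt_deriv_logDeriv_eval {𝕜 : Type*} [NontriviallyNormedField 𝕜] (p : 𝕜[X]) {z : 𝕜}
    (hz : p.eval z ≠ 0) :
    HasDerivAt (fun z => (derivative (derivative p)).eval z / p.eval z
        - ((derivative p).eval z / p.eval z) ^ 2)
      ((derivative (derivative (derivative p))).eval z / p.eval z
        - 3 * ((derivative p).eval z / p.eval z) * ((derivative (derivative p)).eval z / p.eval z)
        + 2 * ((derivative p).eval z / p.eval z) ^ 3) z := by
  refine ((((derivative (derivative p)).hasDerivAt z).div (p.hasDerivAt z) hz).sub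
    ((hasDerivAt_logDeriv_eval p hz).pow 2)).congr_deriv ?_
  simp only [Nat.cast_ofNat, Nat.add_one_sub_one, pow_one]
  field_simp
  ring

/-- For every `n ∈ ℕ`, the rational function `w(z,n) = Qₙ'(z)/Qₙ(z) - Qₙ₊₁'(z)/Qₙ₊₁(z)`
satisfies the second Painlevé equation `w'' = 2w³ + zw + n` at every point where both
`Qₙ` and `Qₙ₊₁` are nonzero. -/
theorem vorobev_yablonski_rational_solution (Q : ℕ → Polynomial ℂ)
    (hQ0 : Q 0 = 1) (hQ1 : Q 1 = 1)
    (hrec : ∀ n : ℕ, Q (n + 2) * Q n =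
      X * (Q (n + 1)) ^ 2 + 4 * (derivative (Q (n + 1))) ^ 2
        - 4 * Q (n + 1) * derivative (derivative (Q (n + 1)))) (n : ℕ) :
    ∀ z : ℂ, (Q n).eval z ≠ 0 → (Q (n + 1)).eval z ≠ 0 →
      HasDerivAt (deriv (fun z : ℂ =>
          (derivative (Q n)).eval z / (Q n).eval z
            - (derivative (Q (n + 1))).eval z / (Q (n + 1)).eval z))
        (2 * ((derivative (Q n)).eval z / (Q n).eval z
            - (derivative (Q (n + 1))).eval z / (Q (n + 1)).eval z) ^ 3
          + z * ((derivative (Q n)).eval z / (Q n).eval z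
            - (derivative (Q (n + 1))).eval z / (Q (n + 1)).eval z) + (n : ℂ)) z := by
  intro z ha hb
  obtain ⟨-, -, h₂, h₃⟩ := vorobev_yablonski_hirota Q hQ0 hQ1 hrec n
  have h₂z := congrArg (eval z) h₂
  have h₃z := congrArg (eval z) h₃
  simp only [eval_add, eval_sub, eval_mul, eval_X, eval_natCast, eval_ofNat, eval_zero]
    at h₂z h₃z
  have hderiv := (hasDerivAt_deriv_logDeriv_eval (Q n) ha).sub
    (hasDerivAt_deriv_logDeriv_eval (Q (n + 1)) hb)
  refine (hderiv.congr_of_eventuallyEq ?_).congr_deriv ?_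
  · filter_upwards [(Q n).continuous.continuousAt.eventually_ne ha,
      (Q (n + 1)).continuous.continuousAt.eventually_ne hb] with y hya hyb
    exact ((hasDerivAt_logDeriv_eval (Q n) hya).sub
      (hasDerivAt_logDeriv_eval (Q (n + 1)) hyb)).deriv
  · generalize eval z (derivative (derivative (derivative (Q n)))) = a₃ at *
    generalize eval z (derivative (derivative (derivative (Q (n + 1))))) = b₃ at *
    generalize eval z (derivative (derivative (Q n))) = a₂ at *
    generalize eval z (derivative (derivative (Q (n + 1)))) = b₂ at *
    generalize eval z (derivative (Q n)) = a₁ at *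
    generalize eval z (derivative (Q (n + 1))) = b₁ at *
    generalize eval z (Q n) = a at *
    generalize eval z (Q (n + 1)) = b at *
    field_simp
    linear_combination a ^ 2 * b ^ 2 * h₃z - 3 * a * b * (a₁ * b - a * b₁) * h₂z
end

section
/- Let α ∈ ℂ and let w be a twice complex differentiable function on an open subset U of ℂ satisfying w''(z) = 2 w(z)³ + z w(z) + α, and set p(z) := w'(z) + w(z)² + z/2. If ξ and η are complex differentiable functions on U satisfying the normal variational equations ξ'(z) = −2 w(z) ξ(z) + η(z) and η'(z) = 2 p(z) ξ(z) + 2 w(z) η(z), then ξ is twice differentiable and satisfies the second-order equation ξ''(z) = (6 w(z)² + z) ξ(z) on U. -/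
/-- If `w` solves the second Painlevé equation with parameter `α` on an open `U ⊆ ℂ`,
`p := w' + w² + z/2`, and `ξ, η` solve the normal variational equations
`ξ' = -2wξ + η`, `η' = 2pξ + 2wη` on `U`, then `ξ` is twice differentiable and satisfies
`ξ'' = (6w² + z) ξ` on `U`. -/
theorem reduced_normal_variational_equation (α : ℂ) (U : Set ℂ) (hU : IsOpen U)
    (w w' : ℂ → ℂ)
    (hw : ∀ z ∈ U, HasDerivAt w (w' z) z)
    (hw' : ∀ z ∈ U, HasDerivAt w' (2 * w z ^ 3 + z * w z + α) z)
    (p : ℂ → ℂ) (hp : p = fun z => w' z + w z ^ 2 + z / 2)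
    (ξ η : ℂ → ℂ)
    (hξ : ∀ z ∈ U, HasDerivAt ξ (-2 * w z * ξ z + η z) z)
    (hη : ∀ z ∈ U, HasDerivAt η (2 * p z * ξ z + 2 * w z * η z) z) :
    ∀ z ∈ U, HasDerivAt (deriv ξ) ((6 * w z ^ 2 + z) * ξ z) z := by
  intro z hz
  have hderiv : HasDerivAt (fun x => -2 * w x * ξ x + η x) ((6 * w z ^ 2 + z) * ξ z) z := by
    refine ((((hw z hz).const_mul (-2)).mul (hξ z hz)).add (hη z hz)).congr_deriv ?_
    rw [hp]
    ring
  refine hderiv.congr_of_eventuallyEq ?_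
  filter_upwards [hU.mem_nhds hz] with x hx
  exact (hξ x hx).deriv
end

section
/- Let n be a positive integer, let r(z) := 6 w(z,n)² + z with w(z,n) := Q_n'(z)/Q_n(z) − Q_{n+1}'(z)/Q_{n+1}(z), and let c ∈ ℂ be any root of Q_n(z) Q_{n+1}(z). Then (z − c)² · r(z) tends to 6 as z → c; that is, every finite pole of r is a double pole with leading Laurent coefficient α_c = 6. -/
open Polynomial Filter

namespace VorobevYablonski

/-- The right-hand side of the Vorobev–Yablonski recursion never vanishes, for degree reasons. -/
lemma rec_ne_zero {p : ℂ[X]} (hp : p ≠ 0) :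
    X * p ^ 2 + 4 * (derivative p) ^ 2 - 4 * p * derivative (derivative p) ≠ 0 := by
  intro h
  have e : X * p ^ 2 = C 4 * (p * derivative (derivative p) - derivative p ^ 2) := by
    have h4 : (C 4 : ℂ[X]) = 4 := rfl
    rw [h4]
    linear_combination h
  have hd : (X * p ^ 2).natDegree = 2 * p.natDegree + 1 := by
    rw [natDegree_X_mul (pow_ne_zero 2 hp), natDegree_pow]
  have h1 := natDegree_derivative_le p
  have h2 := natDegree_derivative_le (derivative p)
  have h3 : (C 4 * (p * derivative (derivative p) - derivative p ^ 2)).natDegree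
      ≤ 2 * p.natDegree := by
    refine (natDegree_C_mul_le _ _).trans ((natDegree_sub_le _ _).trans (max_le ?_ ?_))
    · refine natDegree_mul_le.trans ?_
      omega
    · refine natDegree_pow_le.trans ?_
      omega
  rw [← e, hd] at h3
  omega

lemma ne_zero {Q : ℕ → ℂ[X]} (hQ1 : Q 1 = 1)
    (hrec : ∀ n : ℕ, Q (n + 2) * Q n =
      X * (Q (n + 1)) ^ 2 + 4 * (derivative (Q (n + 1))) ^ 2
        - 4 * Q (n + 1) * derivative (derivative (Q (n + 1)))) (n : ℕ) : Q (n + 1) ≠ 0 := by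
  induction n with
  | zero => simp [hQ1]
  | succ n ih =>
    intro h
    have := hrec n
    rw [show n + 1 + 1 = n + 2 from rfl] at h
    rw [h, zero_mul] at this
    exact rec_ne_zero ih this.symm

/-- The Wronskian relation for `(Qₙ, Qₙ₊₁, Qₙ₊₂)` propagates to `(Qₙ₊₁, Qₙ₊₂, Qₙ₊₃)`, given the
Hirota bilinear relation for `Qₙ₊₁` and `Qₙ₊₂`. -/
lemma wronskian_step {a b c d : ℂ[X]} {k : ℕ} (hb : b ≠ 0)
    (hca : c * a = X * b ^ 2 + 4 * (derivative b) ^ 2 - 4 * b * derivative (derivative b))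
    (hdb : d * b = X * c ^ 2 + 4 * (derivative c) ^ 2 - 4 * c * derivative (derivative c))
    (hA : derivative (derivative c) * b - 2 * derivative c * derivative b
      + c * derivative (derivative b) = 0)
    (hW : derivative c * a - c * derivative a = k * b ^ 2) :
    derivative d * b - d * derivative b = (k + 2 : ℕ) * c ^ 2 := by
  have hca' := congrArg derivative hca
  have hdb' := congrArg derivative hdb
  have hA' := congrArg derivative hA
  have h4 : derivative (4 : ℂ[X]) = 0 := derivative_ofNat 4
  have h2 : derivative (2 : ℂ[X]) = 0 := derivative_ofNat 2
  simp only [derivative_mul, derivative_add, derivative_sub, derivative_pow, derivative_X,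
    h4, h2, derivative_zero] at hca' hdb' hA'
  have hC : (C ((2 : ℕ) : ℂ) : ℂ[X]) = 2 := rfl
  rw [hC] at hca' hdb'
  norm_num at hca' hdb'
  push_cast
  refine mul_left_cancel₀ (pow_ne_zero 2 hb) ?_
  linear_combination b ^ 2 * hdb' - 2 * b * derivative b * hdb + c ^ 2 * hca'
    - 2 * c * derivative c * hca + c ^ 2 * hW - 4 * b * c * hA'
    + (4 * b * derivative c + 4 * c * derivative b) * hA

/-- The Hirota bilinear relation propagates along the sequence. -/
lemma hirota_step {b c d : ℂ[X]} {k : ℕ} (hb : b ≠ 0)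
    (hA : derivative (derivative c) * b - 2 * derivative c * derivative b
      + c * derivative (derivative b) = 0)
    (hW : derivative d * b - d * derivative b = k * c ^ 2) :
    derivative (derivative d) * c - 2 * derivative d * derivative c
      + d * derivative (derivative c) = 0 := by
  have hW' := congrArg derivative hW
  simp only [derivative_mul, derivative_sub, derivative_pow, derivative_natCast] at hW'
  have hC : (C ((2 : ℕ) : ℂ) : ℂ[X]) = 2 := rfl
  rw [hC] at hW'
  norm_num at hW'
  refine mul_left_cancel₀ hb ?_
  linear_combination d * hA + c * hW' - 2 * derivative c * hW

/-- Consecutive Vorobev–Yablonski polynomials satisfy a Hirota bilinear relation, and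
`Qₙ₊₂' Qₙ - Qₙ₊₂ Qₙ' = (2n + 1) Qₙ₊₁²`. -/
lemma hirota_and_wronskian {Q : ℕ → ℂ[X]} (hQ0 : Q 0 = 1) (hQ1 : Q 1 = 1)
    (hrec : ∀ n : ℕ, Q (n + 2) * Q n =
      X * (Q (n + 1)) ^ 2 + 4 * (derivative (Q (n + 1))) ^ 2
        - 4 * Q (n + 1) * derivative (derivative (Q (n + 1)))) (n : ℕ) :
    derivative (derivative (Q (n + 1))) * Q n - 2 * derivative (Q (n + 1)) * derivative (Q n)
      + Q (n + 1) * derivative (derivative (Q n)) = 0 ∧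
    derivative (Q (n + 2)) * Q n - Q (n + 2) * derivative (Q n)
      = (2 * n + 1 : ℕ) * Q (n + 1) ^ 2 := by
  induction n with
  | zero =>
    have h2 : Q 2 = X := by simpa [hQ0, hQ1] using hrec 0
    simp [hQ0, hQ1, h2]
  | succ n ih =>
    obtain ⟨hA, hW⟩ := ih
    have hn : Q n ≠ 0 := by
      cases n with
      | zero => simp [hQ0]
      | succ m => exact ne_zero hQ1 hrec m
    have hA' := hirota_step hn hA hW
    exact ⟨hA', wronskian_step (ne_zero hQ1 hrec n) (hrec n) (hrec (n + 1)) hA' hW⟩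

/-- A nonzero polynomial `p` in Hirota bilinear relation with `q` has only simple roots away from
the roots of `q`. -/
lemma simple_root_of_hirota {p q : ℂ[X]} (hp : p ≠ 0)
    (hA : derivative (derivative p) * q - 2 * derivative p * derivative q
      + p * derivative (derivative q) = 0) {c : ℂ} (hq : q.eval c ≠ 0) (hpc : p.eval c = 0) :
    (derivative p).eval c ≠ 0 := by
  intro hd
  obtain ⟨g, hg, hgc⟩ := exists_eq_pow_rootMultiplicity_mul_and_not_dvd p hp c
  have hm : 1 < p.rootMultiplicity c :=
    (one_lt_rootMultiplicity_iff_isRoot hp).2 ⟨hpc, hd⟩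
  obtain ⟨k, hk⟩ := Nat.exists_eq_add_of_le' hm
  rw [hk] at hg
  rw [dvd_iff_isRoot, IsRoot.def] at hgc
  have hX : derivative (X - C c) = 1 := derivative_X_sub_C c
  have hp1 : derivative p = (X - C c) ^ (k + 1) * (((k + 2 : ℕ) : ℂ[X]) * g + (X - C c) * derivative g) := by
    rw [hg, derivative_mul, derivative_pow, hX]
    simp only [Nat.add_succ_sub_one, map_natCast]
    ring
  have hp2 : derivative (derivative p) = (X - C c) ^ k *
      (((k + 1 : ℕ) : ℂ[X]) * (((k + 2 : ℕ) : ℂ[X]) * g + (X - C c) * derivative g)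
        + (X - C c) * derivative (((k + 2 : ℕ) : ℂ[X]) * g + (X - C c) * derivative g)) := by
    rw [hp1, derivative_mul, derivative_pow, hX]
    simp only [Nat.add_succ_sub_one, map_natCast]
    ring
  rw [hp2, hp1, hg] at hA
  have hA2 : (((k + 1 : ℕ) : ℂ[X]) * (((k + 2 : ℕ) : ℂ[X]) * g + (X - C c) * derivative g)
        + (X - C c) * derivative (((k + 2 : ℕ) : ℂ[X]) * g + (X - C c) * derivative g)) * q
      - 2 * (X - C c) * (((k + 2 : ℕ) : ℂ[X]) * g + (X - C c) * derivative g) * derivative q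
      + (X - C c) ^ 2 * g * derivative (derivative q) = 0 := by
    refine mul_left_cancel₀ (pow_ne_zero k (X_sub_C_ne_zero c)) ?_
    linear_combination hA
  have hev := congrArg (eval c) hA2
  simp only [eval_add, eval_sub, eval_mul, eval_pow, eval_X, eval_C, eval_natCast, sub_self,
    zero_mul, mul_zero, add_zero, sub_zero, eval_zero, ne_eq, OfNat.ofNat_ne_zero,
    not_false_eq_true, zero_pow] at hev
  have h1 : ((k + 1 : ℕ) : ℂ) ≠ 0 := Nat.cast_ne_zero.2 (by omega)
  have h2 : ((k + 2 : ℕ) : ℂ) ≠ 0 := Nat.cast_ne_zero.2 (by omega)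
  exact mul_ne_zero (mul_ne_zero h1 (mul_ne_zero h2 hgc)) hq hev

/-- A simple root of `Qₙ₊₁` is a root of neither neighbour. -/
lemma neighbours_ne_zero {a b d : ℂ[X]}
    (h : d * a = X * b ^ 2 + 4 * (derivative b) ^ 2 - 4 * b * derivative (derivative b))
    {c : ℂ} (hb : b.eval c = 0) (hb' : (derivative b).eval c ≠ 0) :
    d.eval c ≠ 0 ∧ a.eval c ≠ 0 := by
  have hev := congrArg (eval c) h
  simp only [eval_add, eval_sub, eval_mul, eval_pow, eval_X, hb, eval_ofNat] at hev
  have : d.eval c * a.eval c ≠ 0 := by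
    rw [hev]
    simpa using hb'
  exact mul_ne_zero_iff.1 this

lemma simple_root {Q : ℕ → ℂ[X]} (hQ0 : Q 0 = 1) (hQ1 : Q 1 = 1)
    (hrec : ∀ n : ℕ, Q (n + 2) * Q n =
      X * (Q (n + 1)) ^ 2 + 4 * (derivative (Q (n + 1))) ^ 2
        - 4 * Q (n + 1) * derivative (derivative (Q (n + 1)))) (n : ℕ) {c : ℂ}
    (hc : (Q n).eval c = 0) : (derivative (Q n)).eval c ≠ 0 := by
  induction n with
  | zero => simp [hQ0] at hc
  | succ n ih =>
    refine simple_root_of_hirota (ne_zero hQ1 hrec n)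
      (hirota_and_wronskian hQ0 hQ1 hrec n).1 (fun h0 => ?_) hc
    cases n with
    | zero => simp [hQ0] at h0
    | succ m => exact (neighbours_ne_zero (hrec m) h0 (ih h0)).1 hc

lemma tendsto_sub_mul_logDeriv_of_ne_zero {q : ℂ[X]} {c : ℂ} (hq : q.eval c ≠ 0) :
    Tendsto (fun z => (z - c) * ((derivative q).eval z / q.eval z))
      (nhdsWithin c {c}ᶜ) (nhds 0) := by
  have h : ContinuousAt (fun z => (z - c) * ((derivative q).eval z / q.eval z)) c :=
    (continuousAt_id.sub continuousAt_const).mul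
      ((derivative q).continuous.continuousAt.div q.continuous.continuousAt hq)
  simpa using h.tendsto.mono_left nhdsWithin_le_nhds

lemma tendsto_sub_mul_logDeriv_of_simple_root {p : ℂ[X]} {c : ℂ} (hp : p.eval c = 0)
    (hp' : (derivative p).eval c ≠ 0) :
    Tendsto (fun z => (z - c) * ((derivative p).eval z / p.eval z))
      (nhdsWithin c {c}ᶜ) (nhds 1) := by
  obtain ⟨g, hg⟩ := dvd_iff_isRoot.2 hp
  have hpg : (derivative p).eval c = g.eval c := by simp [hg]
  have hgc : g.eval c ≠ 0 := hpg ▸ hp'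
  have h : ContinuousAt (fun z => (derivative p).eval z / g.eval z) c :=
    (derivative p).continuous.continuousAt.div g.continuous.continuousAt hgc
  have ht := h.tendsto.mono_left (nhdsWithin_le_nhds (s := {c}ᶜ))
  rw [hpg, div_self hgc] at ht
  refine ht.congr' ?_
  filter_upwards [self_mem_nhdsWithin] with z hz
  have hz' : z - c ≠ 0 := sub_ne_zero.2 hz
  have hpz : p.eval z = (z - c) * g.eval z := by
    conv_lhs => rw [hg]
    simp
  rw [hpz, ← mul_div_assoc, mul_div_mul_left _ _ hz']

end VorobevYablonski

/-- Every finite pole `c` of `r(z) = 6 w(z,n)² + z` (i.e. every root of `Qₙ Qₙ₊₁`) is a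
double pole with leading Laurent coefficient `6`: `(z - c)² · r(z) → 6` as `z → c`. -/
theorem vorobev_yablonski_double_pole (Q : ℕ → Polynomial ℂ)
    (hQ0 : Q 0 = 1) (hQ1 : Q 1 = 1)
    (hrec : ∀ n : ℕ, Q (n + 2) * Q n =
      X * (Q (n + 1)) ^ 2 + 4 * (derivative (Q (n + 1))) ^ 2
        - 4 * Q (n + 1) * derivative (derivative (Q (n + 1)))) (n : ℕ) (hn : 0 < n)
    (w : ℂ → ℂ)
    (hw : w = fun z => (derivative (Q n)).eval z / (Q n).eval z
      - (derivative (Q (n + 1))).eval z / (Q (n + 1)).eval z)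
    (c : ℂ) (hc : (Q n * Q (n + 1)).eval c = 0) :
    Tendsto (fun z => (z - c) ^ 2 * (6 * w z ^ 2 + z))
      (nhdsWithin c {c}ᶜ) (nhds 6) := by
  have hlim : ∀ s : ℂ, s ^ 2 = 1 → Tendsto (fun z => (z - c) * w z) (nhdsWithin c {c}ᶜ) (nhds s) →
      Tendsto (fun z => (z - c) ^ 2 * (6 * w z ^ 2 + z)) (nhdsWithin c {c}ᶜ) (nhds 6) := by
    intro s hs h
    have hz : Tendsto (fun z : ℂ => (z - c) ^ 2 * z) (nhdsWithin c {c}ᶜ) (nhds 0) := by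
      have : Continuous fun z : ℂ => (z - c) ^ 2 * z := by fun_prop
      simpa using (this.tendsto c).mono_left nhdsWithin_le_nhds
    have := ((h.pow 2).const_mul 6).add hz
    rw [hs, mul_one, add_zero] at this
    exact this.congr fun z => by ring
  rw [eval_mul, mul_eq_zero] at hc
  obtain ⟨m, rfl⟩ := Nat.exists_eq_add_of_le' hn
  rcases hc with hc | hc
  · have hs := VorobevYablonski.simple_root hQ0 hQ1 hrec _ hc
    have hne := (VorobevYablonski.neighbours_ne_zero (hrec m) hc hs).1
    refine hlim 1 (by norm_num) ?_
    have := (VorobevYablonski.tendsto_sub_mul_logDeriv_of_simple_root hc hs).sub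
      (VorobevYablonski.tendsto_sub_mul_logDeriv_of_ne_zero hne)
    rw [sub_zero] at this
    exact this.congr fun z => by rw [hw]; ring
  · have hs := VorobevYablonski.simple_root hQ0 hQ1 hrec _ hc
    have hne := (VorobevYablonski.neighbours_ne_zero (hrec (m + 1)) hc hs).2
    refine hlim (-1) (by norm_num) ?_
    have := (VorobevYablonski.tendsto_sub_mul_logDeriv_of_ne_zero hne).sub
      (VorobevYablonski.tendsto_sub_mul_logDeriv_of_simple_root hc hs)
    rw [zero_sub] at this
    exact this.congr fun z => by rw [hw]; ring
end
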